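/- Complementary form of Kato's inequality: For any N ∈ ℕ, a ∈ ℝ and b ∈ ℝ⁺ with b > |a|, the probability that Λ_N − S_N ≥ [b + a(2Λ_N/N − 1)]√N is at most exp[−2(b² − a²) / (1 − 4a/(3√N))²]. -/

import Mathlib

open MeasureTheory Finset

/-- The tangent line of `1/(x(1-x))` at `r`. -/
lemma kato_tangent (x r : ℝ) (hx0 : 0 < x) (hx1 : x < 1) (hr0 : 0 < r) (hr1 : r < 1) :
    1 / (r * (1 - r)) + (2 * r - 1) / (r * (1 - r)) ^ 2 * (x - r) ≤ 1 / (x * (1 - x)) := by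
  have hg : 0 < r * (1 - r) := mul_pos hr0 (by linarith)
  have hh : 0 < x * (1 - x) := mul_pos hx0 (by linarith)
  have e : 1 / (r * (1 - r)) + (2 * r - 1) / (r * (1 - r)) ^ 2 * (x - r)
      = (r * (1 - r) + (2 * r - 1) * (x - r)) / (r * (1 - r)) ^ 2 := by
    have : 1 - r ≠ 0 := by linarith
    field_simp
  rw [e, div_le_div_iff₀ (by positivity) hh]
  have h1 : r * (1 - r) + (2 * r - 1) * (x - r) ≤ 2 * (r * (1 - r)) - x * (1 - x) := by
    nlinarith [sq_nonneg (x - r)]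
  have h2 := mul_le_mul_of_nonneg_right h1 hh.le
  nlinarith [sq_nonneg (r * (1 - r) - x * (1 - x))]

/-- Refined Pinsker inequality for Bernoulli laws. -/
lemma kato_pinsker (p q : ℝ) (hp0 : 0 < p) (hp1 : p < 1) (hq0 : 0 < q) (hq1 : q < 1) :
    (q - p) ^ 2 / (2 * ((q + 2 * p) / 3 * (1 - (q + 2 * p) / 3)))
      ≤ q * (Real.log q - Real.log p) + (1 - q) * (Real.log (1 - q) - Real.log (1 - p)) := by
  set r : ℝ := (q + 2 * p) / 3 with hr
  have hr0 : 0 < r := by rw [hr]; linarith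
  have hr1 : r < 1 := by rw [hr]; linarith
  set B : ℝ := (2 * r - 1) / (r * (1 - r)) ^ 2 with hB
  set A : ℝ := 1 / (r * (1 - r)) - B * r with hA
  have htan : ∀ x, 0 < x → x < 1 → A + B * x ≤ 1 / (x * (1 - x)) := by
    intro x h0 h1
    have := kato_tangent x r h0 h1 hr0 hr1
    rw [hA, hB] at *
    linarith
  let F : ℝ → ℝ := fun x => q * (Real.log q - Real.log x)
    + (1 - q) * (Real.log (1 - q) - Real.log (1 - x))
    - ((A + B * q) * (q - x) ^ 2 / 2 - B * (q - x) ^ 3 / 3)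
  have hder : ∀ x, 0 < x → x < 1 →
      HasDerivAt F (-(q - x) * (1 / (x * (1 - x)) - (A + B * x))) x := by
    intro x h0 h1
    have d1 := (Real.hasDerivAt_log h0.ne')
    have hs : HasDerivAt (fun y : ℝ => 1 - y) (-1) x := by
      simpa using (hasDerivAt_id x).const_sub 1
    have hsq : HasDerivAt (fun y : ℝ => q - y) (-1) x := by
      simpa using (hasDerivAt_id x).const_sub q
    have hx1 : 1 - x ≠ 0 := by linarith
    have d2 := hs.log hx1
    have d := (((d1.const_sub (Real.log q)).const_mul q).add
      ((d2.const_sub (Real.log (1 - q))).const_mul (1 - q))).sub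
      ((((hsq.pow 2).const_mul (A + B * q)).div_const 2).sub
        (((hsq.pow 3).const_mul B).div_const 3))
    refine d.congr_deriv ?_
    have hx : x ≠ 0 := h0.ne'
    field_simp
    push_cast
    ring
  have hFq : F q = 0 := by simp [F]
  have hFp : 0 ≤ F p := by
    rcases le_total p q with hpq | hpq
    · have hanti : AntitoneOn F (Set.Icc p q) := by
        apply antitoneOn_of_deriv_nonpos (convex_Icc p q)
        · intro x hx
          exact (hder x (by linarith [hx.1]) (by linarith [hx.2])).continuousAt.continuousWithinAt
        · intro x hx
          rw [interior_Icc] at hx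
          exact (hder x (by linarith [hx.1]) (by linarith [hx.2])).differentiableAt.differentiableWithinAt
        · intro x hx
          rw [interior_Icc] at hx
          have h0 : 0 < x := by linarith [hx.1]
          have h1 : x < 1 := by linarith [hx.2]
          rw [(hder x h0 h1).deriv]
          have := htan x h0 h1
          exact mul_nonpos_of_nonpos_of_nonneg (by linarith [hx.2]) (by linarith)
      have := hanti (Set.left_mem_Icc.2 hpq) (Set.right_mem_Icc.2 hpq) hpq
      linarith
    · have hmono : MonotoneOn F (Set.Icc q p) := by
        apply monotoneOn_of_deriv_nonneg (convex_Icc q p)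
        · intro x hx
          exact (hder x (by linarith [hx.1]) (by linarith [hx.2])).continuousAt.continuousWithinAt
        · intro x hx
          rw [interior_Icc] at hx
          exact (hder x (by linarith [hx.1]) (by linarith [hx.2])).differentiableAt.differentiableWithinAt
        · intro x hx
          rw [interior_Icc] at hx
          have h0 : 0 < x := by linarith [hx.1]
          have h1 : x < 1 := by linarith [hx.2]
          rw [(hder x h0 h1).deriv]
          have := htan x h0 h1
          exact mul_nonneg (by linarith [hx.1]) (by linarith)
      have := hmono (Set.left_mem_Icc.2 hpq) (Set.right_mem_Icc.2 hpq) hpq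
      linarith
  have hval : (A + B * q) * (q - p) ^ 2 / 2 - B * (q - p) ^ 3 / 3
      = (q - p) ^ 2 / (2 * (r * (1 - r))) := by
    have e1 : (A + B * q) * (q - p) ^ 2 / 2 - B * (q - p) ^ 3 / 3
        = (q - p) ^ 2 / 2 * (A + B * r) := by rw [hr]; ring
    rw [e1, hA, sub_add_cancel, div_mul_div_comm, mul_one]
  simp only [F] at hFp
  rw [hval] at hFp
  linarith

/-- The one-step bound, for interior `p`, in logarithmic form. -/
lemma kato_lin (p q α β : ℝ) (hp0 : 0 < p) (hp1 : p < 1) (hq0 : 0 < q) (hq1 : q < 1)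
    (hU : 1 - 4 * α / 3 ≠ 0) :
    2 * (β ^ 2 - α ^ 2) / (1 - 4 * α / 3) ^ 2
      + 4 * β / (1 - 4 * α / 3) ^ 2 * (q * (1 - 2 * α) - p + α - β)
      ≤ q * (Real.log q - Real.log p) + (1 - q) * (Real.log (1 - q) - Real.log (1 - p)) := by
  refine le_trans ?_ (kato_pinsker p q hp0 hp1 hq0 hq1)
  set r : ℝ := (q + 2 * p) / 3 with hr
  have hr0 : 0 < r := by rw [hr]; linarith
  have hr1 : r < 1 := by rw [hr]; linarith
  have hg : 0 < r * (1 - r) := mul_pos hr0 (by linarith)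
  rw [le_div_iff₀ (by positivity)]
  set U := 1 - 4 * α / 3 with hUd
  set κ := β / U with hκ
  set ν := α / U with hν
  have e : 2 * (β ^ 2 - α ^ 2) / U ^ 2 + 4 * β / U ^ 2 * (q * (1 - 2 * α) - p + α - β)
      = 4 * κ * (q - p) - 2 * κ ^ 2 - 4 * κ * ν * (2 * r - 1) - 2 * ν ^ 2 := by
    have : q * (1 - 2 * α) - p + α - β = (q - p) * U - α * (2 * r - 1) - β := by
      rw [hUd, hr]; ring
    rw [this, hκ, hν]
    field_simp
    ring
  rw [e]
  have h1 : 4 * κ * (q - p) - 2 * κ ^ 2 - 4 * κ * ν * (2 * r - 1) - 2 * ν ^ 2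
      ≤ 4 * κ * (q - p) - 8 * κ ^ 2 * (r * (1 - r)) := by
    nlinarith [sq_nonneg (κ * (2 * r - 1) + ν)]
  have h2 := mul_le_mul_of_nonneg_right h1 (by positivity : 0 ≤ 2 * (r * (1 - r)))
  nlinarith [sq_nonneg ((q - p) - 4 * κ * (r * (1 - r)))]

/-- One-step moment generating function bound. -/
lemma kato_step (p α β : ℝ) (hp0 : 0 ≤ p) (hp1 : p ≤ 1) (hβ : 0 < β)
    (hU : 1 - 4 * α / 3 ≠ 0) (t R : ℝ) (ht : t = 4 * β / (1 - 4 * α / 3) ^ 2)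
    (hR : R = 2 * (β ^ 2 - α ^ 2) / (1 - 4 * α / 3) ^ 2) :
    Real.exp (t * (α - p)) * (1 + (Real.exp (t * (1 - 2 * α)) - 1) * p)
      ≤ Real.exp (t * β - R) := by
  have hU2 : 0 < (1 - 4 * α / 3) ^ 2 := by positivity
  rcases hp0.eq_or_lt with h | hp0
  · subst h
    simp only [mul_zero, add_zero, mul_one, sub_zero]
    apply Real.exp_le_exp.2
    have : t * β - R - t * α = 2 * (β - α) ^ 2 / (1 - 4 * α / 3) ^ 2 := by
      rw [ht, hR]; field_simp; ring
    have : 0 ≤ 2 * (β - α) ^ 2 / (1 - 4 * α / 3) ^ 2 := by positivity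
    linarith
  rcases hp1.eq_or_lt with h | hp1
  · subst h
    rw [mul_one, add_sub_cancel, ← Real.exp_add]
    apply Real.exp_le_exp.2
    have : t * β - R - (t * (α - 1) + t * (1 - 2 * α))
        = 2 * (β + α) ^ 2 / (1 - 4 * α / 3) ^ 2 := by
      rw [ht, hR]; field_simp; ring
    have : 0 ≤ 2 * (β + α) ^ 2 / (1 - 4 * α / 3) ^ 2 := by positivity
    linarith
  set s := t * (1 - 2 * α) with hs
  set M := 1 + (Real.exp s - 1) * p with hM
  have hes := Real.exp_pos s
  have hM' : M = (1 - p) + p * Real.exp s := by rw [hM]; ring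
  have hpe : 0 < p * Real.exp s := by positivity
  have hMpos : 0 < M := by rw [hM']; linarith
  set q := p * Real.exp s / M with hq
  have hq0 : 0 < q := by positivity
  have h1q : 1 - q = (1 - p) / M := by
    rw [hq, eq_div_iff hMpos.ne', sub_mul, div_mul_cancel₀ _ hMpos.ne', hM']; ring
  have h1p : 0 < 1 - p := by linarith
  have hq1 : q < 1 := by
    have : 0 < 1 - q := by rw [h1q]; positivity
    linarith
  have key := kato_lin p q α β hp0 hp1 hq0 hq1 hU
  rw [← ht, ← hR] at key
  have l1 : Real.log q = Real.log p + s - Real.log M := by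
    rw [hq, Real.log_div hpe.ne' hMpos.ne', Real.log_mul hp0.ne' hes.ne', Real.log_exp]
  have l2 : Real.log (1 - q) = Real.log (1 - p) - Real.log M := by
    rw [h1q, Real.log_div h1p.ne' hMpos.ne']
  rw [l1, l2] at key
  have hlog : t * (α - p) + Real.log M ≤ t * β - R := by
    rw [hs] at key
    linarith
  calc Real.exp (t * (α - p)) * M = Real.exp (t * (α - p) + Real.log M) := by
        rw [Real.exp_add, Real.exp_log hMpos]
    _ ≤ _ := Real.exp_le_exp.2 hlog

/-- The exponential supermartingale bound. -/
lemma kato_mgf {Ω : Type*} {m0 : MeasurableSpace Ω} {μ : Measure Ω} [IsProbabilityMeasure μ]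
    (ξ : ℕ → Ω → ℝ) (hξ01 : ∀ u ω, ξ u ω = 0 ∨ ξ u ω = 1)
    (𝔉 : Filtration ℕ m0)
    (hmart : ∀ v u, v ≤ u → μ[ξ v | 𝔉 u] =ᵐ[μ] ξ v)
    (t α K : ℝ)
    (hK : ∀ p : ℝ, 0 ≤ p → p ≤ 1 →
      Real.exp (t * (α - p)) * (1 + (Real.exp (t * (1 - 2 * α)) - 1) * p) ≤ K) (n : ℕ) :
    ∃ Z : Ω → ℝ, StronglyMeasurable[𝔉 n] Z ∧
      (Z =ᵐ[μ] fun ω => Real.exp (t * ∑ u ∈ Icc 1 n,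
        (ξ u ω * (1 - 2 * α) - (μ[ξ u | 𝔉 (u - 1)]) ω + α))) ∧
      (∃ C : ℝ, ∀ᵐ ω ∂μ, ‖Z ω‖ ≤ C) ∧ ∫ ω, Z ω ∂μ ≤ K ^ n := by
  have hint : ∀ u, Integrable (ξ u) μ := fun u => integrable_condExp.congr (hmart u u le_rfl)
  have hK0 : 0 ≤ K := le_trans (by simp; positivity) (hK 0 le_rfl zero_le_one)
  induction n with
  | zero =>
    refine ⟨fun _ => 1, stronglyMeasurable_const, ?_, ⟨1, by simp⟩, by simp⟩
    simp
  | succ n ih =>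
    obtain ⟨Z, hZm, hZe, ⟨C, hC⟩, hZK⟩ := ih
    set P : Ω → ℝ := μ[ξ (n + 1) | 𝔉 n] with hP
    set η : Ω → ℝ := μ[ξ (n + 1) | 𝔉 (n + 1)] with hη
    have hηξ : η =ᵐ[μ] ξ (n + 1) := hmart (n + 1) (n + 1) le_rfl
    have hPm : StronglyMeasurable[𝔉 n] P := stronglyMeasurable_condExp
    have hηm : StronglyMeasurable[𝔉 (n + 1)] η := stronglyMeasurable_condExp
    have hle : 𝔉 n ≤ 𝔉 (n + 1) := 𝔉.mono (Nat.le_succ n)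
    have hP0 : ∀ᵐ ω ∂μ, 0 ≤ P ω := by
      apply condExp_nonneg
      filter_upwards with ω
      rcases hξ01 (n + 1) ω with h | h <;> simp [h]
    have hP1 : ∀ᵐ ω ∂μ, P ω ≤ 1 := by
      have h := condExp_mono (m := 𝔉 n) (hint (n + 1)) (integrable_const (1 : ℝ))
        (Filter.Eventually.of_forall (fun ω => by
          rcases hξ01 (n + 1) ω with h | h <;> simp [h]) : ξ (n + 1) ≤ᵐ[μ] fun _ => (1 : ℝ))
      rw [condExp_const (𝔉.le n)] at h
      exact h
    set c := Real.exp (t * (1 - 2 * α)) - 1 with hc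
    set E : Ω → ℝ := fun ω => Real.exp (t * (α - P ω)) with hE
    have hEm : StronglyMeasurable[𝔉 n] E :=
      Real.continuous_exp.comp_stronglyMeasurable
        ((stronglyMeasurable_const.sub hPm).const_mul t)
    set G : Ω → ℝ := fun ω => Z ω * E ω with hG
    have hGm : StronglyMeasurable[𝔉 n] G := hZm.mul hEm
    have hEb : ∀ᵐ ω ∂μ, ‖E ω‖ ≤ Real.exp (|t| * (|α| + 1)) := by
      filter_upwards [hP0, hP1] with ω h0 h1
      rw [Real.norm_eq_abs, Real.abs_exp]
      apply Real.exp_le_exp.2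
      calc t * (α - P ω) ≤ |t * (α - P ω)| := le_abs_self _
        _ = |t| * |α - P ω| := abs_mul _ _
        _ ≤ |t| * (|α| + 1) := by
          gcongr
          refine (abs_sub _ _).trans ?_
          rw [abs_of_nonneg h0]
          linarith
    have hGb : ∀ᵐ ω ∂μ, ‖G ω‖ ≤ C * Real.exp (|t| * (|α| + 1)) := by
      filter_upwards [hC, hEb] with ω h1 h2
      rw [hG, norm_mul]
      exact mul_le_mul h1 h2 (norm_nonneg _) ((norm_nonneg _).trans h1)
    have hGi : Integrable G μ :=
      Integrable.of_bound (hGm.mono (𝔉.le n)).aestronglyMeasurable _ hGb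
    have hZi : Integrable Z μ :=
      Integrable.of_bound (hZm.mono (𝔉.le n)).aestronglyMeasurable _ hC
    have hηb : ∀ᵐ ω ∂μ, ‖1 + c * η ω‖ ≤ 1 + |c| := by
      filter_upwards [hηξ] with ω h
      rw [h]
      rcases hξ01 (n + 1) ω with h | h
      · simp [h]
      · rw [h, mul_one]
        simpa using norm_add_le (1 : ℝ) c
    have hGξ : Integrable (fun ω => G ω * ξ (n + 1) ω) μ :=
      (hint (n + 1)).bdd_mul (hGm.mono (𝔉.le n)).aestronglyMeasurable hGb
    have hGP : Integrable (fun ω => G ω * P ω) μ :=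
      (integrable_condExp).bdd_mul (hGm.mono (𝔉.le n)).aestronglyMeasurable hGb
    have hswap : ∫ ω, G ω * ξ (n + 1) ω ∂μ = ∫ ω, G ω * P ω ∂μ := by
      have h1 := condExp_mul_of_stronglyMeasurable_left hGm hGξ (hint (n + 1))
      have h2 := integral_condExp (μ := μ) (f := G * ξ (n + 1)) (𝔉.le n)
      rw [integral_congr_ae h1] at h2
      exact h2.symm
    refine ⟨fun ω => G ω * (1 + c * η ω), (hGm.mono hle).mul
      (stronglyMeasurable_const.add (hηm.const_mul c)), ?_,
      ⟨C * Real.exp (|t| * (|α| + 1)) * (1 + |c|), ?_⟩, ?_⟩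
    · filter_upwards [hZe, hηξ] with ω h1 h2
      rw [Finset.sum_Icc_succ_top (by omega), mul_add t, Real.exp_add, ← h1, h2]
      simp only [hG]
      rw [mul_assoc]
      congr 1
      rw [Nat.add_sub_cancel, ← hP]
      rcases hξ01 (n + 1) ω with h | h
      · rw [h, hE]
        simp only [mul_zero, add_zero, mul_one]
        congr 1; ring
      · rw [h, hE, hc]
        simp only [mul_one, add_sub_cancel]
        rw [← Real.exp_add]
        congr 1; ring
    · filter_upwards [hGb, hηb] with ω h1 h2
      rw [norm_mul]
      exact mul_le_mul h1 h2 (norm_nonneg _) ((norm_nonneg _).trans h1)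
    · calc ∫ ω, G ω * (1 + c * η ω) ∂μ = ∫ ω, (G ω + c * (G ω * ξ (n + 1) ω)) ∂μ := by
            apply integral_congr_ae
            filter_upwards [hηξ] with ω h
            rw [h]; ring
        _ = ∫ ω, G ω ∂μ + c * ∫ ω, G ω * ξ (n + 1) ω ∂μ := by
            rw [integral_add hGi (hGξ.const_mul c), integral_const_mul]
        _ = ∫ ω, (G ω + c * (G ω * P ω)) ∂μ := by
            rw [hswap, integral_add hGi (hGP.const_mul c), integral_const_mul]
        _ ≤ ∫ ω, K * Z ω ∂μ := by
            apply integral_mono_ae (hGi.add (hGP.const_mul c)) (hZi.const_mul K)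
            filter_upwards [hP0, hP1, hZe] with ω h0 h1 h2
            have hZ0 : 0 ≤ Z ω := by rw [h2]; positivity
            have := mul_le_mul_of_nonneg_left (hK (P ω) h0 h1) hZ0
            change G ω + c * (G ω * P ω) ≤ K * Z ω
            simp only [hG, hE]
            linarith
        _ = K * ∫ ω, Z ω ∂μ := integral_const_mul _ _
        _ ≤ K * K ^ n := mul_le_mul_of_nonneg_left hZK hK0
        _ = K ^ (n + 1) := by ring

/-- Complementary form of Kato's inequality (Eq. (34) of the paper): under the same
setup as Kato's inequality — which is assumed as hypothesis `hKato` — the probability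
that `Λ_N - S_N ≥ (b + a(2Λ_N/N - 1))√N` is at most
`exp(-2(b² - a²)/(1 - 4a/(3√N))²)`. -/
theorem kato_inequality_complementary
    {Ω : Type*} {m0 : MeasurableSpace Ω} {μ : Measure Ω} [IsProbabilityMeasure μ]
    (N : ℕ) (hN : 0 < N)
    (ξ : ℕ → Ω → ℝ) (hξ01 : ∀ u ω, ξ u ω = 0 ∨ ξ u ω = 1)
    (𝔉 : Filtration ℕ m0)
    (hmart : ∀ v u, v ≤ u → μ[ξ v | 𝔉 u] =ᵐ[μ] ξ v)
    (hKato : ∀ a' b' : ℝ, 0 < b' → b' > |a'| →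
      μ {ω | (∑ u ∈ Icc 1 N, (μ[ξ u | 𝔉 (u - 1)]) ω) - (∑ u ∈ Icc 1 N, ξ u ω)
          ≥ (b' + a' * (2 * (∑ u ∈ Icc 1 N, ξ u ω) / N - 1)) * Real.sqrt N}
        ≤ ENNReal.ofReal
            (Real.exp (-2 * (b' ^ 2 - a' ^ 2) / (1 + 4 * a' / (3 * Real.sqrt N)) ^ 2)))
    (a b : ℝ) (hb : 0 < b) (hba : b > |a|) :
    μ {ω | (∑ u ∈ Icc 1 N, ξ u ω) - (∑ u ∈ Icc 1 N, (μ[ξ u | 𝔉 (u - 1)]) ω)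
        ≥ (b + a * (2 * (∑ u ∈ Icc 1 N, ξ u ω) / N - 1)) * Real.sqrt N}
      ≤ ENNReal.ofReal
          (Real.exp (-2 * (b ^ 2 - a ^ 2) / (1 - 4 * a / (3 * Real.sqrt N)) ^ 2)) := by
  by_cases hU : 1 - 4 * a / (3 * Real.sqrt N) = 0
  · rw [hU]
    simpa using prob_le_one
  have hNR : (0 : ℝ) < N := by exact_mod_cast hN
  set w := Real.sqrt N with hw
  have hwpos : 0 < w := Real.sqrt_pos.2 hNR
  have hww : w * w = N := Real.mul_self_sqrt hNR.le
  set α := a / w with hα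
  set β := b / w with hβ
  have hβ0 : 0 < β := by positivity
  have hUe : 1 - 4 * a / (3 * w) = 1 - 4 * α / 3 := by
    rw [hα]; field_simp
  rw [hUe] at hU ⊢
  set t := 4 * β / (1 - 4 * α / 3) ^ 2 with ht
  set R := 2 * (β ^ 2 - α ^ 2) / (1 - 4 * α / 3) ^ 2 with hR
  have hU2 : 0 < (1 - 4 * α / 3) ^ 2 := by positivity
  have ht0 : 0 < t := by positivity
  obtain ⟨Z, hZm, hZe, ⟨C, hC⟩, hZK⟩ := kato_mgf ξ hξ01 𝔉 hmart t α (Real.exp (t * β - R))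
    (fun p h0 h1 => kato_step p α β h0 h1 hβ0 hU t R ht hR) N
  have hZi : Integrable Z μ :=
    Integrable.of_bound (hZm.mono (𝔉.le N)).aestronglyMeasurable _ hC
  have hZ0 : 0 ≤ᵐ[μ] Z := by
    filter_upwards [hZe] with ω h
    rw [h]; positivity
  have hmarkov := mul_meas_ge_le_integral_of_nonneg hZ0 hZi (Real.exp (t * (β * N)))
  have hsub : μ {ω | (∑ u ∈ Icc 1 N, ξ u ω) - (∑ u ∈ Icc 1 N, (μ[ξ u | 𝔉 (u - 1)]) ω)
        ≥ (b + a * (2 * (∑ u ∈ Icc 1 N, ξ u ω) / N - 1)) * w}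
      ≤ μ {ω | Real.exp (t * (β * N)) ≤ Z ω} := by
    apply measure_mono_ae
    filter_upwards [hZe] with ω h hω
    change Real.exp (t * (β * N)) ≤ Z ω
    have hω' : (∑ u ∈ Icc 1 N, ξ u ω) - (∑ u ∈ Icc 1 N, (μ[ξ u | 𝔉 (u - 1)]) ω)
        ≥ (b + a * (2 * (∑ u ∈ Icc 1 N, ξ u ω) / N - 1)) * w := hω
    rw [h]
    apply Real.exp_le_exp.2
    apply mul_le_mul_of_nonneg_left _ ht0.le
    rw [sum_add_distrib, sum_sub_distrib, ← sum_mul, sum_const, Nat.card_Icc,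
      Nat.add_sub_cancel, nsmul_eq_mul]
    generalize (∑ u ∈ Icc 1 N, ξ u ω) = L at *
    have e : (b + a * (2 * L / N - 1)) * w = β * N + 2 * α * L - α * N := by
      rw [hα, hβ, ← hww]; field_simp; ring
    rw [e] at hω'
    linarith
  refine hsub.trans ?_
  rw [← ofReal_measureReal]
  apply ENNReal.ofReal_le_ofReal
  have hfin := hmarkov.trans hZK
  rw [← Real.exp_nat_mul, mul_comm, ← le_div_iff₀ (Real.exp_pos _), ← Real.exp_sub] at hfin
  refine hfin.trans (le_of_eq ?_)
  congr 1
  rw [hR, hα, hβ] at *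
  rw [← hww]
  field_simp
  ring
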